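/- arXiv:2505.01477 — 2 statements merged into one kernel-verified Lean document; each statement's English description precedes it below -/
import Mathlib

section
/- There exists a gradient vector field (acyclic matching) V on the matching complex M_7 of the complete graph K_7 such that V has exactly 21 critical 2-simplices, exactly 1 critical 1-simplex, and exactly 1 critical 0-simplex. -/
/-- A simplex of the matching complex `M₇` of the complete graph `K₇`:
a nonempty matching of `K₇`, i.e. a nonempty finite set of pairwise
vertex-disjoint 2-element subsets ("edges") of `Fin 7`.
A `k`-simplex is a matching of size `k + 1`. -/
def IsSimplex (σ : Finset (Finset (Fin 7))) : Prop :=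
  σ.Nonempty ∧ (∀ e ∈ σ, e.card = 2) ∧
    ∀ e ∈ σ, ∀ f ∈ σ, e ≠ f → Disjoint e f

/-- A discrete vector field on `M₇`: a set `V` of pairs `(σ, τ)` of simplices
with `σ ⊂ τ` and `dim τ = dim σ + 1`, such that each simplex of `M₇`
belongs to at most one pair of `V`. -/
def IsDVF (V : Set (Finset (Finset (Fin 7)) × Finset (Finset (Fin 7)))) : Prop :=
  (∀ p ∈ V, IsSimplex p.1 ∧ IsSimplex p.2 ∧ p.1 ⊂ p.2 ∧ p.2.card = p.1.card + 1) ∧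
  (∀ p ∈ V, ∀ q ∈ V, p ≠ q →
    p.1 ≠ q.1 ∧ p.1 ≠ q.2 ∧ p.2 ≠ q.1 ∧ p.2 ≠ q.2)

/-- `V` admits a nontrivial closed `V`-path
`σ₀, τ₀, σ₁, τ₁, …, σₙ = σ₀` with `n ≥ 1`. -/
def HasClosedPath (V : Set (Finset (Finset (Fin 7)) × Finset (Finset (Fin 7)))) : Prop :=
  ∃ (n : ℕ) (σ τ : ℕ → Finset (Finset (Fin 7))),
    0 < n ∧ σ n = σ 0 ∧
    ∀ i < n, (σ i, τ i) ∈ V ∧ σ (i + 1) ⊂ τ i ∧ σ (i + 1) ≠ σ i ∧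
      (σ (i + 1)).card = (σ i).card

/-- A gradient vector field on `M₇`: a discrete vector field admitting no
nontrivial closed `V`-path (an acyclic matching on the face poset). -/
def IsGVF (V : Set (Finset (Finset (Fin 7)) × Finset (Finset (Fin 7)))) : Prop :=
  IsDVF V ∧ ¬ HasClosedPath V

/-- A simplex of `M₇` is critical with respect to `V` if it belongs to no pair of `V`. -/
def IsCritical (V : Set (Finset (Finset (Fin 7)) × Finset (Finset (Fin 7))))
    (σ : Finset (Finset (Fin 7))) : Prop :=
  IsSimplex σ ∧ ∀ p ∈ V, p.1 ≠ σ ∧ p.2 ≠ σ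

/-- The number of critical `k`-simplices of `V` (matchings of size `k + 1`). -/
noncomputable def critCount (V : Set (Finset (Finset (Fin 7)) × Finset (Finset (Fin 7))))
    (k : ℕ) : ℕ :=
  Set.ncard {σ | IsCritical V σ ∧ σ.card = k + 1}

/-- The total number of critical simplices of `V`. -/
noncomputable def totalCrit (V : Set (Finset (Finset (Fin 7)) × Finset (Finset (Fin 7)))) : ℕ :=
  Set.ncard {σ | IsCritical V σ}

/-- Representatives `(σ, e)` of the cyclic orbits of pairs `(σ, insert e σ)` matching
edges of `M₇` with triangles, in an order in which they can be collapsed. -/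
def collapseOrbits : List (Finset (Finset (Fin 7)) × Finset (Fin 7)) :=
  [
    ({{1, 2}, {4, 5}}, {0, 3}),
    ({{0, 6}, {1, 5}}, {2, 4}),
    ({{3, 4}, {5, 6}}, {0, 2}),
    ({{0, 3}, {4, 5}}, {1, 6}),
    ({{0, 5}, {3, 4}}, {1, 6}),
    ({{1, 6}, {3, 4}}, {0, 2}),
    ({{0, 2}, {3, 4}}, {1, 5}),
    ({{2, 4}, {3, 5}}, {1, 6}),
    ({{0, 2}, {3, 5}}, {1, 4}),
    ({{1, 5}, {4, 6}}, {0, 3}),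
    ({{0, 4}, {1, 3}}, {2, 6}),
    ({{1, 5}, {3, 6}}, {0, 4})]

/-- Pairs `(σ, e)` for which `(σ, insert e σ)` matches a vertex of `M₇` with an edge, in an
order in which the edges of a spanning tree can be collapsed to the vertex `{0, 1}`. -/
def treeCollapses : List (Finset (Finset (Fin 7)) × Finset (Fin 7)) :=
  [
    ({{0, 2}}, {1, 5}),
    ({{0, 5}}, {3, 6}),
    ({{0, 6}}, {1, 4}),
    ({{1, 2}}, {3, 6}),
    ({{1, 3}}, {2, 6}),
    ({{1, 6}}, {0, 4}),
    ({{2, 3}}, {0, 4}),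
    ({{2, 4}}, {0, 3}),
    ({{3, 4}}, {1, 5}),
    ({{3, 5}}, {1, 4}),
    ({{1, 4}}, {2, 5}),
    ({{4, 5}}, {2, 6}),
    ({{4, 6}}, {2, 5}),
    ({{5, 6}}, {0, 3}),
    ({{0, 3}}, {2, 6}),
    ({{2, 6}}, {1, 5}),
    ({{1, 5}}, {0, 4}),
    ({{0, 4}}, {3, 6}),
    ({{3, 6}}, {2, 5}),
    ({{2, 5}}, {0, 1})]

/-- The image of an edge of `K₇` under rotation of the vertices by `a`. -/
def rotateEdge (a : Fin 7) (e : Finset (Fin 7)) : Finset (Fin 7) :=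
  e.image (· + a)

/-- All pairs of the gradient vector field, in collapsing order. -/
def gradientPairs : List (Finset (Finset (Fin 7)) × Finset (Finset (Fin 7))) :=
  (collapseOrbits.flatMap fun p => (List.finRange 7).map fun a =>
    (p.1.image (rotateEdge a), (insert p.2 p.1).image (rotateEdge a))) ++
  treeCollapses.map fun p => (p.1, insert p.2 p.1)

instance : DecidablePred IsSimplex := fun σ =>
  inferInstanceAs (Decidable (σ.Nonempty ∧ (∀ e ∈ σ, e.card = 2) ∧
    ∀ e ∈ σ, ∀ f ∈ σ, e ≠ f → Disjoint e f))

/-- A collapsing order: the pairs are pairwise disjoint and the smaller simplex of each pair is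
not a facet of the larger simplex of any later pair. -/
def CollapseCompatible (p q : Finset (Finset (Fin 7)) × Finset (Finset (Fin 7))) : Prop :=
  p.1 ≠ q.1 ∧ p.1 ≠ q.2 ∧ p.2 ≠ q.1 ∧ p.2 ≠ q.2 ∧ ¬ p.1 ⊆ q.2

theorem isDVF_of_pairwise {L : List (Finset (Finset (Fin 7)) × Finset (Finset (Fin 7)))}
    (hL : ∀ p ∈ L, IsSimplex p.1 ∧ IsSimplex p.2 ∧ p.1 ⊂ p.2 ∧ p.2.card = p.1.card + 1)
    (hp : L.Pairwise CollapseCompatible) : IsDVF {p | p ∈ L} := by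
  refine ⟨hL, fun p hpL q hqL hne => ?_⟩
  have hsymm : L.Pairwise fun p q => p.1 ≠ q.1 ∧ p.1 ≠ q.2 ∧ p.2 ≠ q.1 ∧ p.2 ≠ q.2 :=
    hp.imp fun h => ⟨h.1, h.2.1, h.2.2.1, h.2.2.2.1⟩
  have : Std.Symm fun p q : Finset (Finset (Fin 7)) × Finset (Finset (Fin 7)) =>
      p.1 ≠ q.1 ∧ p.1 ≠ q.2 ∧ p.2 ≠ q.1 ∧ p.2 ≠ q.2 :=
    ⟨fun _ _ h => ⟨h.1.symm, h.2.2.1.symm, h.2.1.symm, h.2.2.2.symm⟩⟩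
  exact hsymm.forall
    hpL hqL hne

theorem not_hasClosedPath_of_pairwise
    {L : List (Finset (Finset (Fin 7)) × Finset (Finset (Fin 7)))}
    (hp : L.Pairwise CollapseCompatible) : ¬ HasClosedPath {p | p ∈ L} := by
  rintro ⟨n, σ, τ, hn, hclosed, hstep⟩
  have hidx : ∀ i < n, ∃ k, ∃ h : k < L.length, L[k] = (σ i, τ i) := fun i hi =>
    List.mem_iff_getElem.mp (hstep i hi).1
  choose! f hf hfL using hidx
  have hlt : ∀ i < n, ∀ j < n, σ j = σ (i + 1) → f i < f j := by
    intro i hi j hj hij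
    obtain ⟨-, hsub, hne, -⟩ := hstep i hi
    rw [← hij] at hsub hne
    by_contra! hle
    rcases hle.lt_or_eq with h | h
    · have := (List.pairwise_iff_getElem.mp hp (f j) (f i) (hf j hj) (hf i hi) h).2.2.2.2
      rw [hfL j hj, hfL i hi] at this
      exact this hsub.subset
    · have h1 := hfL j hj
      simp only [h] at h1
      rw [hfL i hi] at h1
      exact hne (congrArg Prod.fst h1).symm
  have hmono : ∀ i < n, f 0 ≤ f i := by
    intro i
    induction i with
    | zero => simp
    | succ i ih =>
      intro hi
      exact (ih (by omega)).trans (hlt i (by omega) (i + 1) hi rfl).le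
  have hlast := hlt (n - 1) (by omega) 0 hn (by rw [Nat.sub_add_cancel hn, hclosed])
  exact absurd (hmono (n - 1) (by omega)) (by omega)

/-- The edges of `K₇`. -/
def edgeList : List (Finset (Fin 7)) :=
  (List.finRange 7).flatMap fun a => ((List.finRange 7).filter (a < ·)).map fun b => {a, b}

theorem mem_edgeList {e : Finset (Fin 7)} : e ∈ edgeList ↔ e.card = 2 := by
  constructor
  · have h : ∀ e ∈ edgeList, e.card = 2 := by decide +kernel
    exact h e
  · have h : ∀ a b : Fin 7, a ≠ b → {a, b} ∈ edgeList := by decide +kernel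
    intro he
    obtain ⟨a, b, hab, rfl⟩ := Finset.card_eq_two.mp he
    exact h a b hab

theorem nodup_edgeList : edgeList.Nodup := by
  decide +kernel

/-- All matchings, including the empty one, whose edges are taken from a given list. -/
def matchings (l : List (Finset (Fin 7))) : List (Finset (Finset (Fin 7))) :=
  l.foldr (fun e m => m ++ (m.filter fun σ => ∀ f ∈ σ, Disjoint e f).map (insert e)) [∅]

theorem matchings_cons (e : Finset (Fin 7)) (l : List (Finset (Fin 7))) :
    matchings (e :: l) = matchings l ++
      ((matchings l).filter fun σ => ∀ f ∈ σ, Disjoint e f).map (insert e) :=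
  rfl

theorem mem_matchings {l : List (Finset (Fin 7))} (hl : l.Nodup) {σ : Finset (Finset (Fin 7))} :
    σ ∈ matchings l ↔ (∀ e ∈ σ, e ∈ l) ∧ ∀ e ∈ σ, ∀ f ∈ σ, e ≠ f → Disjoint e f := by
  induction l generalizing σ with
  | nil =>
    simp only [matchings, List.foldr_nil, List.mem_singleton, List.not_mem_nil]
    constructor
    · rintro rfl
      simp
    · rintro ⟨h, -⟩
      exact Finset.eq_empty_of_forall_notMem h
  | cons a l ih =>
    obtain ⟨ha, hl⟩ := List.nodup_cons.mp hl
    simp only [matchings_cons, List.mem_append, List.mem_map, List.mem_filter, ih hl,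
      decide_eq_true_eq]
    constructor
    · rintro (⟨h, hd⟩ | ⟨ρ, ⟨⟨h, hd⟩, hda⟩, rfl⟩)
      · exact ⟨fun e he => List.mem_cons_of_mem _ (h e he), hd⟩
      · refine ⟨?_, ?_⟩
        · simp only [Finset.mem_insert, List.mem_cons]
          exact fun e he => he.imp_right (h e)
        · simp only [Finset.mem_insert]
          rintro e (rfl | he) f (rfl | hf) hne
          · exact absurd rfl hne
          · exact hda f hf
          · exact (hda e he).symm
          · exact hd e he f hf hne
    · rintro ⟨h, hd⟩
      by_cases hσ : a ∈ σ
      · refine Or.inr ⟨σ.erase a, ⟨⟨?_, ?_⟩, ?_⟩, Finset.insert_erase hσ⟩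
        · intro e he
          obtain ⟨hne, he⟩ := Finset.mem_erase.mp he
          exact (List.mem_cons.mp (h e he)).resolve_left hne
        · exact fun e he f hf => hd e (Finset.mem_of_mem_erase he) f (Finset.mem_of_mem_erase hf)
        · intro f hf
          obtain ⟨hne, hf⟩ := Finset.mem_erase.mp hf
          exact hd a hσ f hf hne.symm
      · refine Or.inl ⟨fun e he => (List.mem_cons.mp (h e he)).resolve_left ?_, hd⟩
        rintro rfl
        exact hσ he

theorem nodup_matchings {l : List (Finset (Fin 7))} (hl : l.Nodup) : (matchings l).Nodup := by
  induction l with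
  | nil => simp [matchings]
  | cons a l ih =>
    obtain ⟨ha, hl⟩ := List.nodup_cons.mp hl
    have hmem : ∀ σ ∈ matchings l, a ∉ σ := fun σ hσ haσ => ha (((mem_matchings hl).mp hσ).1 a haσ)
    rw [matchings_cons, List.nodup_append]
    refine ⟨ih hl, List.Nodup.map_on ?_ ((ih hl).filter _), ?_⟩
    · intro σ hσ τ hτ h
      rw [← Finset.erase_insert (hmem σ (List.mem_of_mem_filter hσ)), h,
        Finset.erase_insert (hmem τ (List.mem_of_mem_filter hτ))]
    · rintro σ hσ τ hτ rfl
      obtain ⟨ρ, -, rfl⟩ := List.mem_map.mp hτ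
      exact hmem _ hσ (Finset.mem_insert_self a ρ)

theorem isSimplex_iff_mem_matchings {σ : Finset (Finset (Fin 7))} :
    IsSimplex σ ↔ σ.Nonempty ∧ σ ∈ matchings edgeList := by
  simp only [IsSimplex, mem_matchings nodup_edgeList, mem_edgeList]

theorem critCount_add_countP
    {L : List (Finset (Finset (Fin 7)) × Finset (Finset (Fin 7)))}
    (hL : ∀ p ∈ L, IsSimplex p.1 ∧ IsSimplex p.2 ∧ p.1 ⊂ p.2 ∧ p.2.card = p.1.card + 1)
    (hp : L.Pairwise CollapseCompatible) (k : ℕ) :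
    critCount {p | p ∈ L} k + (L.flatMap fun p => [p.1, p.2]).countP (·.card = k + 1) =
      (matchings edgeList).countP (·.card = k + 1) := by
  have hnodup : (L.flatMap fun p => [p.1, p.2]).Nodup := by
    rw [List.nodup_flatMap]
    refine ⟨fun p hpL => by simpa using (hL p hpL).2.2.1.ne, hp.imp fun {p q} h => ?_⟩
    obtain ⟨h1, h2, h3, h4, -⟩ := h
    simp [Function.onFun, h1.symm, h2.symm, h3.symm, h4.symm]
  set A := (matchings edgeList).filter (·.card = k + 1) with hA
  set B := (L.flatMap fun p => [p.1, p.2]).filter (·.card = k + 1) with hB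
  have hAcard : A.toFinset.card = (matchings edgeList).countP (·.card = k + 1) := by
    rw [List.toFinset_card_of_nodup ((nodup_matchings nodup_edgeList).filter _),
      List.countP_eq_length_filter]
  have hBcard : B.toFinset.card = (L.flatMap fun p => [p.1, p.2]).countP (·.card = k + 1) := by
    rw [List.toFinset_card_of_nodup (hnodup.filter _), List.countP_eq_length_filter]
  have hmemA : ∀ σ, σ ∈ A.toFinset ↔ IsSimplex σ ∧ σ.card = k + 1 := by
    intro σ
    simp only [hA, List.mem_toFinset, List.mem_filter, decide_eq_true_eq,
      isSimplex_iff_mem_matchings]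
    exact ⟨fun h => ⟨⟨Finset.card_pos.mp (by omega), h.1⟩, h.2⟩, fun h => ⟨h.1.2, h.2⟩⟩
  have hmemB : ∀ σ, σ ∈ B.toFinset ↔ (∃ p ∈ L, σ = p.1 ∨ σ = p.2) ∧ σ.card = k + 1 := by
    intro σ
    simp [hB]
  have hsub : B.toFinset ⊆ A.toFinset := by
    intro σ hσ
    obtain ⟨⟨p, hpL, rfl | rfl⟩, hc⟩ := (hmemB σ).mp hσ
    · exact (hmemA _).mpr ⟨(hL p hpL).1, hc⟩
    · exact (hmemA _).mpr ⟨(hL p hpL).2.1, hc⟩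
  have hcrit : {σ | IsCritical {p | p ∈ L} σ ∧ σ.card = k + 1} =
      ((A.toFinset \ B.toFinset : Finset _) : Set (Finset (Finset (Fin 7)))) := by
    ext σ
    simp only [IsCritical, Set.mem_ofPred_eq, SetLike.mem_coe, Finset.mem_sdiff, hmemA, hmemB]
    constructor
    · rintro ⟨⟨hs, hn⟩, hc⟩
      refine ⟨⟨hs, hc⟩, ?_⟩
      rintro ⟨⟨p, hpL, rfl | rfl⟩, -⟩
      · exact (hn p hpL).1 rfl
      · exact (hn p hpL).2 rfl
    · rintro ⟨⟨hs, hc⟩, hn⟩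
      exact ⟨⟨hs, fun p hpL => ⟨fun h => hn ⟨⟨p, hpL, Or.inl h.symm⟩, hc⟩,
        fun h => hn ⟨⟨p, hpL, Or.inr h.symm⟩, hc⟩⟩⟩, hc⟩
  rw [critCount, hcrit, Set.ncard_coe_finset, ← hAcard, ← hBcard]
  exact Finset.card_sdiff_add_card_eq_card hsub

theorem IsSimplex.mono {σ τ : Finset (Finset (Fin 7))} (hτ : IsSimplex τ) (hσ : σ.Nonempty)
    (h : σ ⊆ τ) : IsSimplex σ :=
  ⟨hσ, fun e he => hτ.2.1 e (h he), fun e he f hf => hτ.2.2 e (h he) f (h hf)⟩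

theorem rotateEdge_injective (a : Fin 7) : Function.Injective (rotateEdge a) :=
  Finset.image_injective (add_left_injective a)

theorem IsSimplex.image_rotateEdge {σ : Finset (Finset (Fin 7))} (hσ : IsSimplex σ) (a : Fin 7) :
    IsSimplex (σ.image (rotateEdge a)) := by
  refine ⟨hσ.1.image _, ?_, ?_⟩
  · simp only [Finset.forall_mem_image]
    intro e he
    rw [rotateEdge, Finset.card_image_of_injective _ (add_left_injective a), hσ.2.1 e he]
  · simp only [Finset.forall_mem_image]
    intro e he f hf hne
    exact (Finset.disjoint_image (add_left_injective a)).mpr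
      (hσ.2.2 e he f hf fun h => hne (congrArg _ h))

theorem gradientPairs_isFacet : ∀ p ∈ gradientPairs,
    IsSimplex p.1 ∧ IsSimplex p.2 ∧ p.1 ⊂ p.2 ∧ p.2.card = p.1.card + 1 := by
  have key : ∀ p ∈ collapseOrbits ++ treeCollapses,
      p.1.Nonempty ∧ p.2 ∉ p.1 ∧ IsSimplex (insert p.2 p.1) := by
    simp only [← List.all_iff_forall_prop]
    decide +kernel
  intro q hq
  rcases List.mem_append.mp hq with hq | hq
  · simp only [List.mem_flatMap, List.mem_map] at hq
    obtain ⟨p, hp, a, -, rfl⟩ := hq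
    obtain ⟨hne, hmem, hs⟩ := key p (List.mem_append_left _ hp)
    have hss := Finset.ssubset_insert hmem
    refine ⟨(hs.mono hne hss.subset).image_rotateEdge a, hs.image_rotateEdge a,
      (Finset.image_ssubset_image (rotateEdge_injective a)).mpr hss, ?_⟩
    rw [Finset.card_image_of_injective _ (rotateEdge_injective a),
      Finset.card_image_of_injective _ (rotateEdge_injective a), Finset.card_insert_of_notMem hmem]
  · obtain ⟨p, hp, rfl⟩ := List.mem_map.mp hq
    obtain ⟨hne, hmem, hs⟩ := key p (List.mem_append_right _ hp)
    have hss := Finset.ssubset_insert hmem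
    exact ⟨hs.mono hne hss.subset, hs, hss, Finset.card_insert_of_notMem hmem⟩

/-- A numerical code of a set of edges, monotone with respect to divisibility. The values of the
factors on the edges of `K₇` are pairwise coprime. -/
def code (σ : Finset (Finset (Fin 7))) : ℕ :=
  ∏ e ∈ σ, (210 * ∏ i ∈ e, ((i : ℕ) + 5) + 19)

theorem code_dvd_code {σ τ : Finset (Finset (Fin 7))} (h : σ ⊆ τ) : code σ ∣ code τ :=
  Finset.prod_dvd_prod_of_subset _ _ _ h

theorem gradientPairs_pairwise : gradientPairs.Pairwise CollapseCompatible := by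
  have key : (gradientPairs.map fun p => (code p.1, code p.2)).Pairwise fun p q =>
      p.1 ≠ q.1 ∧ p.2 ≠ q.1 ∧ p.2 ≠ q.2 ∧ ¬ p.1 ∣ q.2 := by
    decide +kernel
  refine (List.pairwise_map.mp key).imp fun {p q} ⟨h1, h3, h4, h5⟩ => ?_
  have hsub : ¬ p.1 ⊆ q.2 := fun h => h5 (code_dvd_code h)
  exact ⟨fun h => h1 (congrArg code h), fun h => hsub h.subset, fun h => h3 (congrArg code h),
    fun h => h4 (congrArg code h), hsub⟩

theorem countP_matchings_edgeList :
    (List.range 3).map (fun k => (matchings edgeList).countP (·.card = k + 1)) =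
      [21, 105, 105] := by
  decide +kernel

theorem countP_gradientPairs :
    (List.range 3).map (fun k =>
      (gradientPairs.flatMap fun p => [p.1, p.2]).countP (·.card = k + 1)) = [20, 104, 84] := by
  decide +kernel

/-- There exists a gradient vector field on `M₇` with exactly 21 critical
2-simplices, exactly 1 critical 1-simplex, and exactly 1 critical 0-simplex. -/
theorem optimal_gvf_exists_on_M7 :
    ∃ V : Set (Finset (Finset (Fin 7)) × Finset (Finset (Fin 7))),
      IsGVF V ∧ critCount V 2 = 21 ∧ critCount V 1 = 1 ∧ critCount V 0 = 1 := by
  have hcount := critCount_add_countP gradientPairs_isFacet gradientPairs_pairwise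
  have hm := countP_matchings_edgeList
  have hg := countP_gradientPairs
  simp only [List.range_succ, List.range_zero, List.nil_append, List.cons_append, List.map_cons,
    List.map_nil, List.cons.injEq, and_true] at hm hg
  refine ⟨{p | p ∈ gradientPairs},
    ⟨isDVF_of_pairwise gradientPairs_isFacet gradientPairs_pairwise,
      not_hasClosedPath_of_pairwise gradientPairs_pairwise⟩, ?_, ?_, ?_⟩
  · have := hcount 2
    omega
  · have := hcount 1
    omega
  · have := hcount 0
    omega
end

section
/- No gradient vector field (acyclic matching) on the matching complex M_7 of the complete graph K_7 having exactly 22 critical 2-simplices, 2 critical 1-simplices, and 1 critical 0-simplex (hence 25 critical simplices in total) is optimal: there exists a gradient vector field on M_7 with strictly fewer critical simplices in total. In particular, Conjecture 5.1 of the original article (asserting optimality of the gradient vector field M** with these critical counts) is false. -/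
/-- The 21 edges of `K₇`: the edge with index `7 * d + a` is `{a, a + d + 1}`. -/
def edge (i : Fin 21) : Finset (Fin 7) :=
  {Fin.ofNat 7 i, Fin.ofNat 7 (i + i / 7 + 1)}

/-- The set of edges whose indices are the positions of the nonzero binary digits of `c`. -/
def decode (c : ℕ) : Finset (Finset (Fin 7)) :=
  (Finset.univ.filter fun i : Fin 21 => c.testBit i).image edge

/-- An acyclic matching on the face poset of `M₇`, in binary codes. Each pair consists of
the codes of a simplex and of a simplex covering it. -/
def pairCodes : List (ℕ × ℕ) :=
  [(512, 513), (256, 768), (8192, 8704), (131072, 131584), (128, 384), (4096, 135168),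
    (65536, 196608), (262144, 393216), (524288, 655360), (4, 4100), (2, 262146), (32, 262176),
    (2048, 526336), (16384, 540672), (8, 10), (16, 16400), (1048576, 1064960), (64, 72),
    (1024, 1049600), (32768, 1081344), (18432, 542720), (1572864, 1589248), (34, 262178),
    (131074, 393218), (16416, 16418), (2050, 18434), (4098, 135170), (6144, 6146), (2052, 6148),
    (786432, 917504), (524292, 526340), (262148, 786436), (4104, 4106), (49152, 1097728),
    (524800, 655872), (36, 262180), (32800, 49184), (32772, 32804), (131073, 131585),
    (36864, 36868), (1052672, 1085440), (1048584, 1052680), (16896, 541184), (40, 42),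
    (4608, 135680), (524296, 1572872), (544, 16928), (33, 545), (9, 41), (65537, 196609),
    (12288, 12800), (24576, 25088), (327680, 458752), (65544, 65545), (524352, 524360),
    (8208, 24592), (5, 37), (8196, 12292), (65600, 65608), (576, 524864), (320, 832),
    (1048592, 1064976), (20, 8212), (4352, 4864), (65792, 65856), (17, 21), (1048832, 1052928),
    (2049, 2053), (262400, 327936), (1048577, 1048593), (1025, 1049601), (1310720, 1310976),
    (3072, 3073), (263168, 1311744), (1026, 263170), (288, 800), (67584, 67585), (2304, 6400),
    (2176, 2432), (272, 1048848), (144, 400), (8320, 8336), (1152, 3200), (81920, 83968),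
    (9216, 9344), (73728, 90112), (270336, 271360), (8200, 12296), (33792, 1082368),
    (32896, 33920), (136, 8328), (524416, 524424), (131200, 655488), (163840, 163968),
    (160, 32928), (68, 524356), (80, 84), (131088, 131089), (66, 74), (18, 82), (1536, 1537),
    (1088, 1090), (32832, 33856), (98304, 229376)]

/-- The codes of the simplices that do not occur in `pairCodes`. -/
def critCodes : List ℕ :=
  [73736, 114688, 131216, 1048585, 32836, 98368, 270340, 1600, 9728, 526464, 16402, 168, 131090,
    336, 416, 167936, 335872, 67840, 1835008, 262432, 3074, 16386, 1]

/-- The acyclic matching on `M₇` encoded by `pairCodes`. -/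
def matchedPairs : List (Finset (Finset (Fin 7)) × Finset (Finset (Fin 7))) :=
  pairCodes.map fun p => (decode p.1, decode p.2)

theorem edge_injective : Function.Injective edge := by
  unfold Function.Injective
  decide +kernel

theorem exists_edge_eq {e : Finset (Fin 7)} (he : e.card = 2) : ∃ i, edge i = e := by
  obtain ⟨a, b, hab, rfl⟩ := Finset.card_eq_two.1 he
  revert a b
  decide +kernel

theorem edge_mem_decode {c : ℕ} {i : Fin 21} : edge i ∈ decode c ↔ c.testBit i := by
  simp [decode, edge_injective.eq_iff]

theorem land_eq_of_decode_subset {c d : ℕ} (hc : c < 2 ^ 21) (h : decode c ⊆ decode d) :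
    c &&& d = c := by
  refine Nat.eq_of_testBit_eq fun i => ?_
  rw [Nat.testBit_land]
  rcases lt_or_ge i 21 with hi | hi
  · have := @h (edge ⟨i, hi⟩)
    rw [edge_mem_decode, edge_mem_decode] at this
    cases hci : c.testBit i <;> simp_all
  · simp [Nat.testBit_lt_two_pow (hc.trans_le (Nat.pow_le_pow_right two_pos hi))]

theorem decode_injOn {c d : ℕ} (hc : c < 2 ^ 21) (hd : d < 2 ^ 21)
    (h : decode c = decode d) : c = d := by
  rw [← land_eq_of_decode_subset hc h.subset, Nat.land_comm,
    land_eq_of_decode_subset hd h.superset]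

theorem card_decode (c : ℕ) :
    (decode c).card = (Finset.univ.filter fun i : Fin 21 => c.testBit i).card :=
  Finset.card_image_of_injective _ edge_injective

theorem card_edge (i : Fin 21) : (edge i).card = 2 := by
  revert i
  decide +kernel

theorem decode_eq_of_forall {c : ℕ} {s : Finset (Fin 21)} (h : ∀ i : Fin 21, c.testBit i ↔ i ∈ s) :
    decode c = s.image edge := by
  simp [decode, h]

theorem isSimplex_decode {c : ℕ} (hc : ∃ i : Fin 21, c.testBit i)
    (h : ∀ i : Fin 21, c.testBit i → ∀ j : Fin 21, c.testBit j → i ≠ j →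
      Disjoint (edge i) (edge j)) : IsSimplex (decode c) := by
  obtain ⟨i, hi⟩ := hc
  refine ⟨⟨edge i, edge_mem_decode.2 hi⟩, ?_, ?_⟩
  · simp only [decode, Finset.forall_mem_image]
    exact fun i _ => card_edge i
  · simp only [decode, Finset.forall_mem_image, Finset.mem_filter_univ]
    exact fun i hi j hj hij => h i hi j hj fun e => hij (e ▸ rfl)

theorem IsSimplex.card_le_three {σ : Finset (Finset (Fin 7))} (h : IsSimplex σ) :
    σ.card ≤ 3 := by
  have h1 : (σ.biUnion id).card = ∑ e ∈ σ, e.card := Finset.card_biUnion h.2.2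
  have h2 : (σ.biUnion id).card ≤ 7 := (Finset.card_le_univ _).trans (by simp)
  rw [h1, Finset.sum_congr rfl h.2.1] at h2
  simp at h2
  omega

/-- The indices of the edges of a matching, in the form of at most three pairwise disjoint edges. -/
theorem IsSimplex.exists_edges {σ : Finset (Finset (Fin 7))} (h : IsSimplex σ) :
    (∃ i, σ = {edge i}) ∨
    (∃ i j, Disjoint (edge i) (edge j) ∧ σ = {edge i, edge j}) ∨
    ∃ i j, Disjoint (edge i) (edge j) ∧ ∃ k, Disjoint (edge i) (edge k) ∧
      Disjoint (edge j) (edge k) ∧ σ = {edge i, edge j, edge k} := by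
  have h0 := h.1.card_pos
  have h3 := h.card_le_three
  obtain ⟨-, h2, hd⟩ := h
  obtain hc | hc | hc : σ.card = 1 ∨ σ.card = 2 ∨ σ.card = 3 := by omega
  · obtain ⟨a, rfl⟩ := Finset.card_eq_one.1 hc
    obtain ⟨i, rfl⟩ := exists_edge_eq (h2 a (by simp))
    exact .inl ⟨i, rfl⟩
  · obtain ⟨a, b, hab, rfl⟩ := Finset.card_eq_two.1 hc
    obtain ⟨i, rfl⟩ := exists_edge_eq (h2 a (by simp))
    obtain ⟨j, rfl⟩ := exists_edge_eq (h2 b (by simp))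
    exact .inr (.inl ⟨i, j, hd _ (by simp) _ (by simp) hab, rfl⟩)
  · obtain ⟨a, b, c, hab, hac, hbc, rfl⟩ := Finset.card_eq_three.1 hc
    obtain ⟨i, rfl⟩ := exists_edge_eq (h2 a (by simp))
    obtain ⟨j, rfl⟩ := exists_edge_eq (h2 b (by simp))
    obtain ⟨k, rfl⟩ := exists_edge_eq (h2 c (by simp))
    exact .inr (.inr ⟨i, j, hd _ (by simp) _ (by simp) hab, k, hd _ (by simp) _ (by simp) hac,
      hd _ (by simp) _ (by simp) hbc, rfl⟩)

/-- The codes of all simplices of `M₇`. -/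
def simplexCodes : List ℕ :=
  critCodes ++ (pairCodes.map Prod.fst ++ pairCodes.map Prod.snd)

theorem IsSimplex.exists_code {σ : Finset (Finset (Fin 7))} (h : IsSimplex σ) :
    ∃ c ∈ simplexCodes, decode c = σ := by
  obtain ⟨i, rfl⟩ | ⟨i, j, hij, rfl⟩ | ⟨i, j, hij, k, hik, hjk, rfl⟩ := h.exists_edges
  · have key : ∀ i : Fin 21, 2 ^ i.val ∈ simplexCodes := by decide +kernel
    refine ⟨_, key i, ?_⟩
    rw [decode_eq_of_forall (s := {i})]
    · simp
    · intro l
      simp [Nat.testBit_two_pow, Fin.ext_iff, eq_comm (a := l.val)]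
  · have key : ∀ i j : Fin 21, Disjoint (edge i) (edge j) →
        2 ^ i.val ||| 2 ^ j.val ∈ simplexCodes := by decide +kernel
    refine ⟨_, key i j hij, ?_⟩
    rw [decode_eq_of_forall (s := {i, j})]
    · simp
    · intro l
      simp [Nat.testBit_two_pow, Fin.ext_iff, eq_comm (a := l.val)]
  · have key : ∀ i j : Fin 21, Disjoint (edge i) (edge j) → ∀ k : Fin 21,
        Disjoint (edge i) (edge k) → Disjoint (edge j) (edge k) →
        2 ^ i.val ||| (2 ^ j.val ||| 2 ^ k.val) ∈ simplexCodes := by decide +kernel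
    refine ⟨_, key i j hij k hik hjk, ?_⟩
    rw [decode_eq_of_forall (s := {i, j, k})]
    · simp
    · intro l
      simp [Nat.testBit_two_pow, Fin.ext_iff, eq_comm (a := l.val)]

/-- In a list in which no entry has a lower simplex contained in the upper simplex of an earlier
entry, passing to another facet of an upper simplex decreases the position in the list. -/
theorem idxOf_lt_of_subset {α : Type*} [DecidableEq α]
    {L : List (Finset α × Finset α)} (hL : ∀ p ∈ L, p.1 ⊆ p.2)
    (hR : L.Pairwise fun p q => ¬ q.1 ⊆ p.2) {s t s' : Finset α} (hst : (s, t) ∈ L)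
    (hs' : s' ∈ L.map Prod.fst) (hsub : s' ⊆ t) (hne : s' ≠ s) :
    (L.map Prod.fst).idxOf s' < (L.map Prod.fst).idxOf s := by
  have hnodup : (L.map Prod.fst).Nodup :=
    List.pairwise_map.2 <| hR.imp_of_mem fun {p q} hp _ h e => h (e ▸ hL p hp)
  have key := List.pairwise_iff_getElem.1 hR
  obtain ⟨k, hk, hkst⟩ := List.getElem_of_mem hst
  obtain ⟨k', hk', rfl⟩ := List.getElem_of_mem hs'
  obtain rfl : (L.map Prod.fst)[k]'(by simpa using hk) = s := by simp [hkst]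
  rw [hnodup.idxOf_getElem, hnodup.idxOf_getElem]
  by_contra! hle
  rcases hle.eq_or_lt with rfl | hlt
  · exact hne rfl
  · have hk'' : k' < L.length := by simpa using hk'
    refine key k k' hk hk'' hlt ?_
    rw [hkst]
    simpa using hsub

/-- A list of pairs of simplices is a gradient vector field if no entry has a lower simplex
contained in the upper simplex of an earlier entry, and no upper simplex occurs in an
earlier entry. -/
theorem isGVF_of_pairwise {L : List (Finset (Finset (Fin 7)) × Finset (Finset (Fin 7)))}
    (hL : ∀ p ∈ L, IsSimplex p.1 ∧ IsSimplex p.2 ∧ p.1 ⊂ p.2 ∧ p.2.card = p.1.card + 1)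
    (hR : L.Pairwise fun p q => ¬ q.1 ⊆ p.2 ∧ q.2 ≠ p.1 ∧ q.2 ≠ p.2) :
    IsGVF {p | p ∈ L} := by
  refine ⟨⟨hL, ?_⟩, ?_⟩
  · have key := List.pairwise_iff_getElem.1 hR
    have ordered : ∀ i j (hi : i < L.length) (hj : j < L.length), i < j →
        L[i].1 ≠ L[j].1 ∧ L[i].1 ≠ L[j].2 ∧ L[i].2 ≠ L[j].1 ∧ L[i].2 ≠ L[j].2 := by
      intro i j hi hj hij
      obtain ⟨h1, h2, h3⟩ := key i j hi hj hij
      have hsub := (hL _ (List.getElem_mem hi)).2.2.1.subset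
      exact ⟨fun e => h1 (e ▸ hsub), h2.symm, fun e => h1 e.superset, h3.symm⟩
    intro p hp q hq hpq
    obtain ⟨i, hi, rfl⟩ := List.getElem_of_mem hp
    obtain ⟨j, hj, rfl⟩ := List.getElem_of_mem hq
    rcases lt_trichotomy i j with hij | rfl | hij
    · exact ordered i j hi hj hij
    · exact absurd rfl hpq
    · obtain ⟨h1, h2, h3, h4⟩ := ordered j i hj hi hij
      exact ⟨h1.symm, h3.symm, h2.symm, h4.symm⟩
  · rintro ⟨n, σ, τ, hn, hclosed, hpath⟩
    have hmem : ∀ i < n, σ i ∈ L.map Prod.fst := fun i hi =>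
      List.mem_map.2 ⟨_, (hpath i hi).1, rfl⟩
    have step : ∀ i < n,
        (L.map Prod.fst).idxOf (σ (i + 1)) < (L.map Prod.fst).idxOf (σ i) := by
      intro i hi
      obtain ⟨hV, hsub, hne, -⟩ := hpath i hi
      refine idxOf_lt_of_subset (fun p hp => (hL p hp).2.2.1.subset)
        (hR.imp fun h => h.1) hV ?_ hsub.subset hne
      rcases (Nat.succ_le_of_lt hi).eq_or_lt with h | h
      · rw [← Nat.succ_eq_add_one, h, hclosed]
        exact hmem 0 hn
      · exact hmem _ h
    have descent : ∀ i ≤ n,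
        (L.map Prod.fst).idxOf (σ i) + i ≤ (L.map Prod.fst).idxOf (σ 0) := by
      intro i
      induction i with
      | zero => simp
      | succ i ih =>
        intro hi
        have := ih (by omega)
        have := step i hi
        omega
    have := descent n le_rfl
    rw [hclosed] at this
    omega

theorem matchedPairs_isGVF : IsGVF {p | p ∈ matchedPairs} := by
  have bound : ∀ p ∈ pairCodes, p.1 < 2 ^ 21 ∧ p.2 < 2 ^ 21 := by decide +kernel
  apply isGVF_of_pairwise
  · have lower : ∀ p ∈ pairCodes, p.2 &&& p.1 = p.1 ∧ ∃ i : Fin 21, p.1.testBit i := by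
      decide +kernel
    have upper : ∀ p ∈ pairCodes, ∀ i : Fin 21, p.2.testBit i → ∀ j : Fin 21, p.2.testBit j →
        i ≠ j → Disjoint (edge i) (edge j) := by decide +kernel
    have card : ∀ p ∈ pairCodes, (Finset.univ.filter fun i : Fin 21 => p.2.testBit i).card =
        (Finset.univ.filter fun i : Fin 21 => p.1.testBit i).card + 1 := by decide +kernel
    simp only [matchedPairs, List.forall_mem_map]
    intro p hp
    obtain ⟨hland, i, hi⟩ := lower p hp
    have hbit : ∀ j : ℕ, p.1.testBit j → p.2.testBit j := by
      intro j hj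
      rw [← hland, Nat.testBit_land, Bool.and_eq_true] at hj
      exact hj.1
    have hcard : (decode p.2).card = (decode p.1).card + 1 := by
      simpa only [card_decode] using card p hp
    have hsub : decode p.1 ⊆ decode p.2 :=
      Finset.image_subset_image (Finset.monotone_filter_right _ fun j _ => hbit j)
    refine ⟨isSimplex_decode ⟨i, hi⟩ fun i hi j hj => upper p hp i (hbit i hi) j (hbit j hj),
      isSimplex_decode ⟨i, hbit i hi⟩ (upper p hp), ?_, hcard⟩
    exact hsub.ssubset_of_ne fun e => by simp [e] at hcard
  · have pairwise : pairCodes.Pairwise fun p q => p.2 &&& q.1 ≠ q.1 ∧ q.2 ≠ p.1 ∧ q.2 ≠ p.2 := by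
      decide +kernel
    refine List.pairwise_map.2 (pairwise.imp_of_mem fun {p q} hp hq h => ⟨fun hsub => ?_, ?_, ?_⟩)
    · exact h.1 (Nat.land_comm _ _ ▸ land_eq_of_decode_subset (bound q hq).1 hsub)
    · exact fun e => h.2.1 (decode_injOn (bound q hq).2 (bound p hp).1 e)
    · exact fun e => h.2.2 (decode_injOn (bound q hq).2 (bound p hp).2 e)

theorem totalCrit_matchedPairs_le : totalCrit {p | p ∈ matchedPairs} ≤ 23 := by
  have hsub : {σ | IsCritical {p | p ∈ matchedPairs} σ} ⊆
      ((critCodes.map decode).toFinset : Set (Finset (Finset (Fin 7)))) := by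
    rintro σ ⟨hσ, hcrit⟩
    obtain ⟨c, hc, rfl⟩ := hσ.exists_code
    have hpair : ∀ p ∈ pairCodes, decode p.1 ≠ decode c ∧ decode p.2 ≠ decode c :=
      fun p hp => hcrit (decode p.1, decode p.2) (List.mem_map.2 ⟨p, hp, rfl⟩)
    simp only [simplexCodes, List.mem_append, List.mem_map] at hc
    obtain hc | ⟨p, hp, rfl⟩ | ⟨p, hp, rfl⟩ := hc
    · simpa using ⟨c, hc, rfl⟩
    · exact absurd rfl (hpair p hp).1
    · exact absurd rfl (hpair p hp).2
  calc totalCrit {p | p ∈ matchedPairs}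
      ≤ (critCodes.map decode).toFinset.card := by
        rw [← Set.ncard_coe_finset]
        exact Set.ncard_le_ncard hsub
    _ ≤ (critCodes.map decode).length := List.toFinset_card_le _
    _ = 23 := by simp [critCodes]

theorem critCount_add_le_totalCrit
    (V : Set (Finset (Finset (Fin 7)) × Finset (Finset (Fin 7)))) :
    critCount V 2 + critCount V 1 + critCount V 0 ≤ totalCrit V := by
  unfold critCount totalCrit
  rw [← Set.ncard_union_eq, ← Set.ncard_union_eq]
  · refine Set.ncard_le_ncard ?_
    rintro σ ((h | h) | h) <;> exact h.1
  all_goals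
    rw [Set.disjoint_left]
    intro σ
    simp only [Set.mem_union, Set.mem_ofPred_eq]
    omega

/-- No gradient vector field on `M₇` with exactly 22 critical 2-simplices,
2 critical 1-simplices, and 1 critical 0-simplex is optimal: there is a
gradient vector field on `M₇` with strictly fewer critical simplices in total. -/
theorem conjecture_5_1_false
    (V : Set (Finset (Finset (Fin 7)) × Finset (Finset (Fin 7)))) (hV : IsGVF V)
    (h2 : critCount V 2 = 22) (h1 : critCount V 1 = 2) (h0 : critCount V 0 = 1) :
    ∃ W : Set (Finset (Finset (Fin 7)) × Finset (Finset (Fin 7))),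
      IsGVF W ∧ totalCrit W < totalCrit V := by
  have := critCount_add_le_totalCrit V
  have := totalCrit_matchedPairs_le
  exact ⟨_, matchedPairs_isGVF, by omega⟩
end
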